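/- Let B ∈ ℤ_max^{n×p}, and let P ∈ ℤ_max^{n×n} and Q ∈ ℤ_max^{p×p} be invertible matrices over ℤ_max (i.e. there exist P⁻¹, Q⁻¹ with PP⁻¹ = P⁻¹P = I and QQ⁻¹ = Q⁻¹Q = I, where I is the max-plus identity matrix). Then vol(Im(PBQ)) = vol(Im B). -/

import Mathlib

/-- The max-plus matrix–vector product over `ℤ_max = (ℤ ∪ {−∞}, max, +)`:
`(Ax)_i = max_j (A_{ij} + x_j)`. -/
def maxMulVec {m k : ℕ} (A : Matrix (Fin m) (Fin k) (WithBot ℤ))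
    (x : Fin k → WithBot ℤ) : Fin m → WithBot ℤ :=
  fun i => Finset.univ.sup fun j => A i j + x j

/-- The max-plus matrix product: `(AB)_{ij} = max_t (A_{it} + B_{tj})`. -/
def maxMatMul {m k l : ℕ} (A : Matrix (Fin m) (Fin k) (WithBot ℤ))
    (B : Matrix (Fin k) (Fin l) (WithBot ℤ)) : Matrix (Fin m) (Fin l) (WithBot ℤ) :=
  Matrix.of fun i j => Finset.univ.sup fun t => A i t + B t j

/-- `Im A`: the subsemimodule generated by the columns of `A`, i.e. the set of all
max-plus linear combinations `Ay` of the columns of `A`. -/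
def ImM {m k : ℕ} (A : Matrix (Fin m) (Fin k) (WithBot ℤ)) : Set (Fin m → WithBot ℤ) :=
  {v | ∃ y : Fin k → WithBot ℤ, v = maxMulVec A y}

/-- A subsemimodule of `ℤ_max^m`: contains `(−∞,…,−∞)`, is closed under entrywise max,
and under addition of a scalar `λ ∈ ℤ ∪ {−∞}` to all entries. -/
def IsSubsemimodule {m : ℕ} (X : Set (Fin m → WithBot ℤ)) : Prop :=
  (fun _ => ⊥) ∈ X ∧ (∀ x ∈ X, ∀ y ∈ X, x ⊔ y ∈ X) ∧
    ∀ (c : WithBot ℤ), ∀ x ∈ X, (fun i => c + x i) ∈ X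

/-- The volume of a subset of `ℤ_max^m`: the cardinality (in `ℕ ∪ {∞}`) of the set
of its elements `x` with `max_i x_i = 0`. -/
noncomputable def vol {m : ℕ} (X : Set (Fin m → WithBot ℤ)) : ℕ∞ :=
  {x ∈ X | Finset.univ.sup x = (0 : WithBot ℤ)}.encard

/-- The max-plus identity matrix: `0` on the diagonal and `−∞` elsewhere. -/
def idMax (m : ℕ) : Matrix (Fin m) (Fin m) (WithBot ℤ) :=
  Matrix.of fun i j => if i = j then (0 : WithBot ℤ) else ⊥

theorem sup_const_add {ι : Type*} (s : Finset ι) (c : WithBot ℤ) (f : ι → WithBot ℤ) :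
    (s.sup fun j => c + f j) = c + s.sup f := by
  classical
  induction s using Finset.induction_on with
  | empty => simp
  | insert a s _ ih => rw [Finset.sup_insert, Finset.sup_insert, ih]; exact max_add_add_left c _ _

theorem maxMulVec_const_add {m k : ℕ} (A : Matrix (Fin m) (Fin k) (WithBot ℤ)) (c : WithBot ℤ)
    (x : Fin k → WithBot ℤ) :
    maxMulVec A (fun j => c + x j) = fun i => c + maxMulVec A x i := by
  funext i
  simp only [maxMulVec]
  rw [← sup_const_add]
  congr 1
  funext j
  exact add_left_comm _ _ _

theorem maxMulVec_matMul {m k l : ℕ} (A : Matrix (Fin m) (Fin k) (WithBot ℤ))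
    (B : Matrix (Fin k) (Fin l) (WithBot ℤ)) (x : Fin l → WithBot ℤ) :
    maxMulVec (maxMatMul A B) x = maxMulVec A (maxMulVec B x) := by
  funext i
  simp only [maxMulVec, maxMatMul, Matrix.of_apply]
  simp_rw [← sup_const_add]
  rw [Finset.sup_comm]
  congr 1
  funext j
  rw [add_comm, ← sup_const_add]
  congr 1
  funext t
  rw [add_comm, add_assoc]

theorem maxMulVec_id {m : ℕ} (x : Fin m → WithBot ℤ) : maxMulVec (idMax m) x = x := by
  funext i
  simp only [maxMulVec, idMax, Matrix.of_apply]
  apply le_antisymm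
  · apply Finset.sup_le
    intro j _
    by_cases h : i = j
    · simp [h]
    · simp [h]
  · refine le_trans ?_ (Finset.le_sup (Finset.mem_univ i))
    simp

theorem maxMulVec_bot {m k : ℕ} (A : Matrix (Fin m) (Fin k) (WithBot ℤ)) :
    maxMulVec A (fun _ => ⊥) = fun _ => ⊥ := by
  funext i
  simp [maxMulVec]

theorem ImM_const_add {m k : ℕ} (A : Matrix (Fin m) (Fin k) (WithBot ℤ)) (c : WithBot ℤ)
    (x : Fin m → WithBot ℤ) (hx : x ∈ ImM A) : (fun i => c + x i) ∈ ImM A := by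
  obtain ⟨y, rfl⟩ := hx
  exact ⟨_, (maxMulVec_const_add A c y).symm⟩

theorem vol_le_of_leftInv {m : ℕ} (X Y : Set (Fin m → WithBot ℤ))
    (P R : Matrix (Fin m) (Fin m) (WithBot ℤ)) (hRP : maxMatMul R P = idMax m)
    (hY : ∀ (c : WithBot ℤ), ∀ y ∈ Y, (fun i => c + y i) ∈ Y)
    (hXY : ∀ x ∈ X, maxMulVec P x ∈ Y) : vol X ≤ vol Y := by
  have hinv : ∀ x, maxMulVec R (maxMulVec P x) = x := fun x => by
    rw [← maxMulVec_matMul, hRP, maxMulVec_id]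
  let e : (Fin m → WithBot ℤ) → ℤ := fun x => -((Finset.univ.sup (maxMulVec P x)).unbotD 0)
  let f : (Fin m → WithBot ℤ) → (Fin m → WithBot ℤ) :=
    fun x i => (e x : WithBot ℤ) + maxMulVec P x i
  have hRf : ∀ x, maxMulVec R (f x) = fun i => (e x : WithBot ℤ) + x i := fun x => by
    rw [maxMulVec_const_add, hinv]
  unfold vol
  apply Set.encard_le_encard_of_injOn (f := f)
  · rintro x ⟨hx, hx0⟩
    refine ⟨hY _ _ (hXY x hx), ?_⟩
    have hne : Finset.univ.sup (maxMulVec P x) ≠ ⊥ := by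
      intro h
      rw [Finset.sup_eq_bot_iff] at h
      have h2 : maxMulVec P x = fun _ => ⊥ := funext fun i => h i (Finset.mem_univ i)
      have h3 := hinv x
      rw [h2, maxMulVec_bot] at h3
      rw [← h3] at hx0
      simp at hx0
    obtain ⟨d, hd⟩ := WithBot.ne_bot_iff_exists.1 hne
    have : Finset.univ.sup (f x) = (e x : WithBot ℤ) + Finset.univ.sup (maxMulVec P x) :=
      sup_const_add _ _ _
    rw [this]
    simp only [e]
    rw [← hd, WithBot.unbotD_coe, ← WithBot.coe_add]
    simp
  · rintro x ⟨_, hx0⟩ y ⟨_, hy0⟩ hxy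
    have h := congrArg (maxMulVec R) hxy
    rw [hRf, hRf] at h
    have hs := congrArg (fun z => Finset.univ.sup z) h
    simp only [sup_const_add, hx0, hy0, add_zero] at hs
    funext i
    have hi := congrFun h i
    simp only [hs] at hi
    exact WithBot.add_left_cancel WithBot.coe_ne_bot hi

/-- If `P` and `Q` are invertible matrices over `ℤ_max`, then
`vol(Im(PBQ)) = vol(Im B)`. -/
theorem vol_imPBQ_eq_vol_imB {n p : ℕ} (B : Matrix (Fin n) (Fin p) (WithBot ℤ))
    (P : Matrix (Fin n) (Fin n) (WithBot ℤ)) (Q : Matrix (Fin p) (Fin p) (WithBot ℤ))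
    (hP : ∃ Pinv : Matrix (Fin n) (Fin n) (WithBot ℤ),
      maxMatMul P Pinv = idMax n ∧ maxMatMul Pinv P = idMax n)
    (hQ : ∃ Qinv : Matrix (Fin p) (Fin p) (WithBot ℤ),
      maxMatMul Q Qinv = idMax p ∧ maxMatMul Qinv Q = idMax p) :
    vol (ImM (maxMatMul (maxMatMul P B) Q)) = vol (ImM B) := by
  obtain ⟨Pi, hP1, hP2⟩ := hP
  obtain ⟨Qi, hQ1, hQ2⟩ := hQ
  apply le_antisymm
  · apply vol_le_of_leftInv _ _ Pi P hP1 (ImM_const_add B)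
    rintro _ ⟨y, rfl⟩
    refine ⟨maxMulVec Q y, ?_⟩
    rw [maxMulVec_matMul, maxMulVec_matMul, ← maxMulVec_matMul Pi, hP2, maxMulVec_id]
  · apply vol_le_of_leftInv _ _ P Pi hP2 (ImM_const_add _)
    rintro _ ⟨y, rfl⟩
    refine ⟨maxMulVec Qi y, ?_⟩
    rw [maxMulVec_matMul, maxMulVec_matMul, ← maxMulVec_matMul Q, hQ1, maxMulVec_id]
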